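/- Fix R > 0. Suppose S ⊆ ℝ² is a measurable set contained in the closed right triangle T′ with corners (0,0), (0,R), (R,0). Let I_V be the line segment from (−R,−R) to (−R,2R) and I_H the line segment from (−R,−R) to (2R,−R). Then there exist absolute constants c, C > 0 (independent of S and R) such that c · Fav(S) ≤ ∫_{I_V ∪ I_H} vis(a;S) da ≤ C · Fav(S), where the integral is taken with respect to one-dimensional Lebesgue (arc-length) measure on I_V ∪ I_H. -/

import Mathlib

open MeasureTheory Metric Set

/-- The radial projection from the vantage point `a`: `P_a(x) = (x - a)/|x - a|`. -/
noncomputable def radialProj (a x : ℂ) : ℂ := ‖x - a‖⁻¹ • (x - a)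

/-- The visibility of `S` from `a`. -/
noncomputable def vis (a : ℂ) (S : Set ℂ) : ℝ :=
  (μH[1] (radialProj a '' (S \ {a}))).toReal / (2 * Real.pi)

/-- The linear projection `π_θ(x,y) = x cos θ + y sin θ`. -/
noncomputable def linproj (θ : ℝ) (z : ℂ) : ℝ := z.re * Real.cos θ + z.im * Real.sin θ

/-- The Favard length of a planar set. -/
noncomputable def Fav (S : Set ℂ) : ℝ :=
  (1 / Real.pi) * ∫ θ in (0:ℝ)..Real.pi, (volume (linproj θ '' S)).toReal

/-- The closed right triangle with corners `(0,0)`, `(0,R)`, `(R,0)`. -/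
noncomputable def Tprime (R : ℝ) : Set ℂ :=
  convexHull ℝ ({⟨0, 0⟩, ⟨0, R⟩, ⟨R, 0⟩} : Set ℂ)

/-- The vertical segment from `(-R,-R)` to `(-R,2R)`. -/
noncomputable def IV (R : ℝ) : Set ℂ := segment ℝ (⟨-R, -R⟩ : ℂ) (⟨-R, 2 * R⟩ : ℂ)

/-- The horizontal segment from `(-R,-R)` to `(2R,-R)`. -/
noncomputable def IH (R : ℝ) : Set ℂ := segment ℝ (⟨-R, -R⟩ : ℂ) (⟨2 * R, -R⟩ : ℂ)

section Aux
open MeasureTheory Metric Set Filter Topology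

lemma cap_tail {α : Type*} [TopologicalSpace α] (f : (ℕ → ℕ) → α) (hf : Continuous f)
    (n : ℕ → ℕ) (U : Set α) (hU : IsOpen U) (hK : f '' {x | ∀ i, x i ≤ n i} ⊆ U) :
    ∃ k, f '' {x | ∀ i < k, x i ≤ n i} ⊆ U := by
  by_contra! hcon
  have h1 : ∀ k, ∃ x : ℕ → ℕ, (∀ i < k, x i ≤ n i) ∧ f x ∉ U := by
    intro k
    obtain ⟨y, ⟨x, hx, rfl⟩, hy⟩ := Set.not_subset.1 (hcon k)
    exact ⟨x, hx, hy⟩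
  choose x hx hxU using h1
  have hcomp : IsCompact {x : ℕ → ℕ | ∀ i, x i ≤ n i} := by
    have : {x : ℕ → ℕ | ∀ i, x i ≤ n i} = Set.pi Set.univ (fun i => Set.Iic (n i)) := by
      ext; simp [Pi.le_def]
    rw [this]
    exact isCompact_univ_pi (fun i => (Set.finite_Iic (n i)).isCompact)
  obtain ⟨a, ha, φ, hφ, hlim⟩ := hcomp.tendsto_subseq
    (x := fun k i => min (x k i) (n i)) (fun k i => min_le_right _ _)
  have hlim2 : Tendsto (fun k => x (φ k)) atTop (𝓝 a) := by
    rw [tendsto_pi_nhds] at hlim ⊢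
    intro i
    refine (hlim i).congr' ?_
    filter_upwards [eventually_gt_atTop i] with k hk
    have : i < φ k := lt_of_lt_of_le hk (hφ.id_le k)
    simpa using hx (φ k) i this
  have h2 : Tendsto (fun k => f (x (φ k))) atTop (𝓝 (f a)) := (hf.tendsto a).comp hlim2
  have h3 := h2.eventually (hU.mem_nhds (hK ⟨a, ha, rfl⟩))
  obtain ⟨k, hk⟩ := h3.exists
  exact hxU _ hk

lemma cap_exists {α : Type*} [MeasurableSpace α] (μ : Measure α)
    (f : (ℕ → ℕ) → α) (c : ENNReal) (hc : c < μ (range f)) :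
    ∃ n : ℕ → ℕ, ∀ k, c < μ (f '' {x | ∀ i < k, x i ≤ n i}) := by
  have step : ∀ (k : ℕ) (T : {T : Set (ℕ → ℕ) // c < μ (f '' T)}),
      ∃ m : ℕ, c < μ (f '' (T.1 ∩ {x | x k ≤ m})) := by
    rintro k ⟨T, hT⟩
    have hU : f '' T = ⋃ m : ℕ, f '' (T ∩ {x | x k ≤ m}) := by
      rw [← image_iUnion, ← inter_iUnion]
      congr 1
      ext x
      simp only [mem_inter_iff, mem_iUnion, mem_ofPred_eq]
      exact ⟨fun h => ⟨h, x k, le_rfl⟩, fun h => h.1⟩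
    have hmono : Monotone (fun m : ℕ => f '' (T ∩ {x | x k ≤ m})) := by
      intro a b hab
      apply image_mono
      rintro x ⟨h1, h2⟩
      exact ⟨h1, le_trans h2 hab⟩
    rw [hU, hmono.measure_iUnion] at hT
    exact lt_iSup_iff.1 hT
  choose m hm using step
  let T : ℕ → {T : Set (ℕ → ℕ) // c < μ (f '' T)} := fun k =>
    Nat.rec ⟨univ, by rwa [image_univ]⟩ (fun k T => ⟨T.1 ∩ {x | x k ≤ m k T}, hm k T⟩) k
  refine ⟨fun k => m k (T k), fun k => ?_⟩
  have : {x : ℕ → ℕ | ∀ i < k, x i ≤ m i (T i)} = (T k).1 := by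
    induction k with
    | zero => simp [T]
    | succ k ih =>
      have e : (T (k+1)).1 = (T k).1 ∩ {x | x k ≤ m k (T k)} := rfl
      rw [e, ← ih]
      ext x
      simp only [mem_ofPred_eq, mem_inter_iff]
      exact Nat.forall_lt_succ_right
  rw [this]
  exact (T k).2

lemma analytic_null {α : Type*} [PseudoMetricSpace α] [T2Space α] [MeasurableSpace α] [BorelSpace α]
    (μ : Measure α) [IsFiniteMeasure μ] {A : Set α} (hA : AnalyticSet A) :
    NullMeasurableSet A μ := by
  have key : ∀ c < μ A, ∃ K ⊆ A, MeasurableSet K ∧ c ≤ μ K := by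
    intro c hc
    rw [AnalyticSet] at hA
    rcases hA with rfl | ⟨f, hf, rfl⟩
    · simp at hc
    obtain ⟨n, hn⟩ := cap_exists μ f c hc
    have hcomp : IsCompact {x : ℕ → ℕ | ∀ i, x i ≤ n i} := by
      have : {x : ℕ → ℕ | ∀ i, x i ≤ n i} = Set.pi Set.univ (fun i => Set.Iic (n i)) := by
        ext; simp [Pi.le_def]
      rw [this]
      exact isCompact_univ_pi (fun i => (Set.finite_Iic (n i)).isCompact)
    refine ⟨f '' {x | ∀ i, x i ≤ n i}, image_subset_range _ _,
      (hcomp.image hf).isClosed.measurableSet, ?_⟩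
    rw [Set.measure_eq_iInf_isOpen]
    refine le_iInf₂ fun U hKU => le_iInf fun hU => ?_
    obtain ⟨k, hk⟩ := cap_tail f hf n U hU hKU
    exact (hn k).le.trans (measure_mono hk)
  rcases eq_or_ne (μ A) 0 with h0 | h0
  · exact NullMeasurableSet.of_null h0
  obtain ⟨u, -, hu, hlim⟩ := exists_seq_strictMono_tendsto' (pos_iff_ne_zero.2 h0)
  choose K hKA hKm hK using fun n => key (u n) (hu n).2
  have hB : MeasurableSet (⋃ n, K n) := MeasurableSet.iUnion hKm
  have hle : μ A ≤ μ (⋃ n, K n) :=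
    le_of_tendsto' hlim fun n => (hK n).trans (measure_mono (subset_iUnion K n))
  have hBA : (⋃ n, K n) ⊆ A := iUnion_subset hKA
  have : (⋃ n, K n) =ᵐ[μ] A :=
    ae_eq_of_subset_of_measure_ge hBA hle hB.nullMeasurableSet (measure_ne_top _ _)
  exact hB.nullMeasurableSet.congr this

lemma analytic_null' {α : Type*} [PseudoMetricSpace α] [T2Space α] [MeasurableSpace α]
    [BorelSpace α] (μ : Measure α) [SFinite μ] {A : Set α} (hA : AnalyticSet A) :
    NullMeasurableSet A μ := by
  obtain ⟨ν, hν, hμν, -⟩ := exists_isFiniteMeasure_absolutelyContinuous μ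
  exact (analytic_null ν hA).mono_ac hμν

lemma slice_fubini {α β : Type*} [MeasurableSpace α] [MeasurableSpace β] (μ : Measure α)
    (ν : Measure β) [SFinite μ] [SFinite ν] {G : Set (α × β)}
    (hG : NullMeasurableSet G (μ.prod ν)) :
    AEMeasurable (fun a => ν {b | (a, b) ∈ G}) μ ∧
    AEMeasurable (fun b => μ {a | (a, b) ∈ G}) ν ∧
    ∫⁻ a, ν {b | (a, b) ∈ G} ∂μ = ∫⁻ b, μ {a | (a, b) ∈ G} ∂ν := by
  obtain ⟨G', hm, he⟩ := hG
  have h1 : ∀ᵐ a ∂μ, ν {b | (a, b) ∈ G} = ν {b | (a, b) ∈ G'} := by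
    filter_upwards [Measure.ae_ae_of_ae_prod he] with a ha
    exact measure_congr ha
  have h2 : ∀ᵐ b ∂ν, μ {a | (a, b) ∈ G} = μ {a | (a, b) ∈ G'} := by
    have he' : ∀ᵐ p ∂(ν.prod μ), G p.swap = G' p.swap := by
      have := Measure.prod_swap (μ := ν) (ν := μ)
      rw [← this] at he
      exact ae_of_ae_map measurable_swap.aemeasurable he
    filter_upwards [Measure.ae_ae_of_ae_prod he'] with a ha
    exact measure_congr ha
  refine ⟨⟨_, measurable_measure_prodMk_left hm, h1⟩, ⟨_, measurable_measure_prodMk_right hm, h2⟩, ?_⟩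
  rw [lintegral_congr_ae h1, lintegral_congr_ae h2]
  exact (Measure.prod_apply hm).symm.trans (Measure.prod_apply_symm hm)
noncomputable def hh (A B : Set ℂ) (θ : ℝ) : ℝ :=
  (volume (linproj θ '' A ∩ linproj θ '' B)).toReal

noncomputable def sw (z : ℂ) : ℂ := ⟨z.im, z.re⟩

noncomputable def gV (R s : ℝ) : ℂ := ⟨-R, s⟩

noncomputable def ee (θ : ℝ) : ℂ := ⟨Real.sin θ, -Real.cos θ⟩

lemma linproj_add_pi (θ : ℝ) (z : ℂ) : linproj (θ + Real.pi) z = -linproj θ z := by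
  simp [linproj]; ring

lemma linproj_sw (θ : ℝ) (z : ℂ) : linproj θ (sw z) = linproj (Real.pi / 2 - θ) z := by
  simp [linproj, sw, Real.cos_pi_div_two_sub, Real.sin_pi_div_two_sub]; ring

lemma hh_periodic (A B : Set ℂ) : Function.Periodic (hh A B) Real.pi := by
  intro θ
  have h : ∀ C : Set ℂ, linproj (θ + Real.pi) '' C = Neg.neg ⁻¹' (linproj θ '' C) := by
    intro C
    ext t
    simp only [mem_image, mem_preimage, linproj_add_pi]
    constructor
    · rintro ⟨z, hz, rfl⟩; exact ⟨z, hz, by simp⟩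
    · rintro ⟨z, hz, h⟩; exact ⟨z, hz, by simp [h]⟩
  unfold hh
  rw [h, h, ← preimage_inter, Measure.measure_preimage_neg]

lemma hh_sw (A B : Set ℂ) (θ : ℝ) : hh (sw '' A) (sw '' B) θ = hh A B (Real.pi / 2 - θ) := by
  have h : ∀ C : Set ℂ, linproj θ '' (sw '' C) = linproj (Real.pi / 2 - θ) '' C := by
    intro C
    rw [image_image]
    simp only [linproj_sw]
  unfold hh
  rw [h, h]

lemma hh_integral_sw (A B : Set ℂ) :
    ∫ θ in (0:ℝ)..Real.pi, hh (sw '' A) (sw '' B) θ = ∫ θ in (0:ℝ)..Real.pi, hh A B θ := by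
  simp only [hh_sw]
  rw [intervalIntegral.integral_comp_sub_left (fun θ => hh A B θ) (Real.pi / 2)]
  have := (hh_periodic A B).intervalIntegral_add_eq (Real.pi / 2 - Real.pi) 0
  rw [zero_add] at this
  rw [← this]
  congr 1; ring

lemma hh_integrable_sw (A B : Set ℂ) (h : IntervalIntegrable (hh A B) volume 0 Real.pi) :
    IntervalIntegrable (hh (sw '' A) (sw '' B)) volume 0 Real.pi := by
  have e : hh (sw '' A) (sw '' B) = fun θ => hh A B (Real.pi / 2 - θ) := by
    ext θ; exact hh_sw A B θ
  rw [e]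
  have h2 : IntervalIntegrable (hh A B) volume (Real.pi / 2 - 0) (Real.pi / 2 - Real.pi) :=
    (hh_periodic A B).intervalIntegrable₀ Real.pi_pos.ne' h _ _
  have h3 := h2.comp_sub_left (Real.pi / 2)
  simpa using h3

lemma radial_eq (R s : ℝ) (hR : 0 < R) (S : Set ℂ) (hS : ∀ z ∈ S, 0 ≤ z.re) :
    radialProj (gV R s) '' (S \ {gV R s}) =
      ee '' {θ | (∃ z ∈ S, linproj θ (gV R s) = linproj θ z) ∧ θ ∈ Ioo 0 Real.pi} := by
  ext u
  constructor
  · rintro ⟨z, ⟨hz, -⟩, rfl⟩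
    have hre : 0 < (z - gV R s).re := by
      have := hS z hz
      simp [gV]; linarith
    have harg := Complex.abs_arg_lt_pi_div_two_iff.2 (Or.inl hre)
    rw [abs_lt] at harg
    have hne : z - gV R s ≠ 0 := by
      intro h; rw [h] at hre; simp at hre
    have hn : ‖z - gV R s‖ ≠ 0 := norm_ne_zero_iff.2 hne
    have hc := Complex.cos_arg hne
    have hs := Complex.sin_arg (z - gV R s)
    refine ⟨Complex.arg (z - gV R s) + Real.pi / 2, ⟨⟨z, hz, ?_⟩, ?_, ?_⟩, ?_⟩
    · have h1 : (z - gV R s).re * Real.sin (Complex.arg (z - gV R s))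
          = (z - gV R s).im * Real.cos (Complex.arg (z - gV R s)) := by
        rw [hc, hs]; field_simp
      simp only [linproj, Real.cos_add_pi_div_two, Real.sin_add_pi_div_two]
      simp only [Complex.sub_re, Complex.sub_im] at h1
      linarith
    · linarith [harg.1]
    · linarith [harg.2]
    · apply Complex.ext
      · simp [ee, radialProj, Real.sin_add_pi_div_two, hc]; ring
      · simp [ee, radialProj, Real.cos_add_pi_div_two, hs]; ring
  · rintro ⟨θ, ⟨⟨z, hz, h⟩, h0, hpi⟩, rfl⟩
    have hre : 0 < (z - gV R s).re := by
      have := hS z hz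
      simp [gV]; linarith
    have hsin : 0 < Real.sin θ := Real.sin_pos_of_pos_of_lt_pi h0 hpi
    refine ⟨z, ⟨hz, ?_⟩, ?_⟩
    · rintro rfl; simp at hre
    · set r := (z - gV R s).re / Real.sin θ with hr
      have hrpos : 0 < r := div_pos hre hsin
      have hw : z - gV R s = r • ee θ := by
        apply Complex.ext
        · simp only [Complex.real_smul, Complex.re_ofReal_mul, ee, hr]; field_simp
        · simp only [Complex.real_smul, Complex.im_ofReal_mul, ee, hr]
          simp only [linproj] at h
          field_simp
          simp only [Complex.sub_re, Complex.sub_im]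
          linarith
      have hnorm : ‖ee θ‖ = 1 := by
        rw [Complex.norm_eq_sqrt_sq_add_sq]
        simp [ee]
      unfold radialProj
      rw [hw, norm_smul, hnorm, smul_smul, Real.norm_of_nonneg hrpos.le, mul_one,
        inv_mul_cancel₀ hrpos.ne', one_smul]

lemma ee_dist (θ τ : ℝ) : dist (ee θ) (ee τ) = 2 * |Real.sin ((θ - τ) / 2)| := by
  rw [dist_eq_norm, Complex.norm_eq_sqrt_sq_add_sq]
  rw [Real.sqrt_eq_iff_mul_self_eq (by positivity) (by positivity)]
  have h1 : (2 * |Real.sin ((θ - τ) / 2)|) * (2 * |Real.sin ((θ - τ) / 2)|)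
      = 4 * Real.sin ((θ - τ) / 2) ^ 2 := by
    rw [← sq_abs (Real.sin _)]; ring
  rw [h1, Real.sin_sq_eq_half_sub]
  have : 2 * ((θ - τ) / 2) = θ - τ := by ring
  rw [this, Real.cos_sub]
  simp only [ee, Complex.sub_re, Complex.sub_im]
  nlinarith [Real.sin_sq_add_cos_sq θ, Real.sin_sq_add_cos_sq τ]

lemma ee_lip : LipschitzWith 1 ee := by
  refine LipschitzWith.of_dist_le_mul fun θ τ => ?_
  rw [ee_dist, Real.dist_eq]
  have := Real.abs_sin_le_abs (x := (θ - τ) / 2)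
  rw [abs_div, abs_two] at this
  simp
  linarith

lemma ee_anti {θ τ : ℝ} (h : θ ∈ Ioo 0 Real.pi) (h' : τ ∈ Ioo 0 Real.pi) :
    dist θ τ ≤ 2 * dist (ee θ) (ee τ) := by
  rw [ee_dist, Real.dist_eq]
  have habs : |θ - τ| ≤ Real.pi := by
    rw [abs_le]; constructor <;> linarith [h.1, h.2, h'.1, h'.2]
  have h1 := Real.mul_le_sin (x := |θ - τ| / 2) (by positivity) (by linarith)
  have h2 : Real.sin (|θ - τ| / 2) ≤ |Real.sin ((θ - τ) / 2)| := by
    rcases abs_cases (θ - τ) with ⟨h, -⟩ | ⟨h, -⟩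
    · rw [h]; exact le_abs_self _
    · rw [h, neg_div, Real.sin_neg]; exact neg_le_abs _
  have h3 : 2 / Real.pi ≥ 1 / 2 := by
    rw [ge_iff_le, div_le_div_iff₀ (by norm_num) Real.pi_pos]; linarith [Real.pi_le_four]
  have h4 : 1 / 2 * (|θ - τ| / 2) ≤ 2 / Real.pi * (|θ - τ| / 2) :=
    mul_le_mul_of_nonneg_right h3 (by positivity)
  linarith

lemma ee_le (A : Set ℝ) : μH[1] (ee '' A) ≤ volume A := by
  have := ee_lip.hausdorffMeasure_image_le (d := 1) (by norm_num) A
  simpa [hausdorffMeasure_real] using this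

lemma ee_ge (A : Set ℝ) (hA : A ⊆ Ioo 0 Real.pi) : volume A ≤ 2 * μH[1] (ee '' A) := by
  have hinj : InjOn ee A := by
    intro x hx y hy h
    have := ee_anti (hA hx) (hA hy)
    rw [h, dist_self, mul_zero] at this
    exact dist_le_zero.1 this
  have hleft := hinj.leftInvOn_invFunOn
  have hl : LipschitzOnWith 2 (Function.invFunOn ee A) (ee '' A) := by
    refine LipschitzOnWith.of_dist_le_mul ?_
    rintro _ ⟨x, hx, rfl⟩ _ ⟨y, hy, rfl⟩
    rw [hleft hx, hleft hy]
    exact ee_anti (hA hx) (hA hy)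
  have := hl.hausdorffMeasure_image_le (d := 1) (by norm_num)
  rw [hleft.image_image] at this
  simpa [hausdorffMeasure_real] using this
lemma linproj_cont : Continuous (fun p : ℝ × ℂ => linproj p.1 p.2) := by
  unfold linproj; fun_prop

lemma gV_cont (R : ℝ) : Continuous (gV R) := by
  have : gV R = fun s : ℝ => (-R : ℂ) + s * Complex.I := by
    ext s; apply Complex.ext <;> simp [gV]
  rw [this]; fun_prop

lemma GV_analytic (R : ℝ) (S : Set ℂ) (hS : MeasurableSet S) :
    AnalyticSet {p : ℝ × ℝ | ∃ z ∈ S, linproj p.1 (gV R p.2) = linproj p.1 z} := by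
  have hm : MeasurableSet {q : (ℝ × ℝ) × ℂ | q.2 ∈ S ∧
      linproj q.1.1 (gV R q.1.2) = linproj q.1.1 q.2} := by
    refine (measurable_snd hS).inter (measurableSet_eq_fun ?_ ?_)
    · exact (linproj_cont.comp (by have := gV_cont R; fun_prop :
        Continuous fun q : (ℝ × ℝ) × ℂ => (q.1.1, gV R q.1.2))).measurable
    · exact (linproj_cont.comp (by fun_prop :
        Continuous fun q : (ℝ × ℝ) × ℂ => (q.1.1, q.2))).measurable
  convert hm.analyticSet.image_of_continuous continuous_fst using 1
  ext p
  simp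

lemma FV_analytic (S : Set ℂ) (hS : MeasurableSet S) :
    AnalyticSet {p : ℝ × ℝ | p.2 ∈ linproj p.1 '' S} := by
  have hm : MeasurableSet {q : (ℝ × ℝ) × ℂ | q.2 ∈ S ∧ linproj q.1.1 q.2 = q.1.2} := by
    refine (measurable_snd hS).inter (measurableSet_eq_fun ?_ ?_)
    · exact (linproj_cont.comp (by fun_prop :
        Continuous fun q : (ℝ × ℝ) × ℂ => (q.1.1, q.2))).measurable
    · fun_prop
  convert hm.analyticSet.image_of_continuous continuous_fst using 1
  ext p
  simp

lemma HV_analytic (R : ℝ) (S : Set ℂ) (hS : MeasurableSet S) :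
    AnalyticSet {p : ℝ × ℂ | p.2 ∈ radialProj (gV R p.1) '' (S \ {gV R p.1})} := by
  have hg := (gV_cont R).measurable
  have hm : MeasurableSet {q : (ℝ × ℂ) × ℂ | (q.2 ∈ S ∧ ¬ q.2 = gV R q.1.1) ∧
      radialProj (gV R q.1.1) q.2 = q.1.2} := by
    refine ((measurable_snd hS).inter (measurableSet_eq_fun ?_ ?_).compl).inter
      (measurableSet_eq_fun ?_ ?_)
    · fun_prop
    · fun_prop
    · unfold radialProj; fun_prop
    · fun_prop
  convert hm.analyticSet.image_of_continuous continuous_fst using 1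
  ext p
  simp

open Pointwise in
lemma g_eq (R : ℝ) (S : Set ℂ) (θ : ℝ) (hs : 0 < Real.sin θ) :
    volume (linproj θ '' S ∩ linproj θ '' (gV R '' Icc (-R) (2 * R))) =
      ENNReal.ofReal (Real.sin θ) *
        volume ({s | ∃ z ∈ S, linproj θ (gV R s) = linproj θ z} ∩ Icc (-R) (2 * R)) := by
  set X := {s | ∃ z ∈ S, linproj θ (gV R s) = linproj θ z} ∩ Icc (-R) (2 * R)
  have h1 : linproj θ '' S ∩ linproj θ '' (gV R '' Icc (-R) (2 * R)) =
      (fun t => (-R * Real.cos θ) + t) '' (Real.sin θ • X) := by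
    ext t
    simp only [mem_inter_iff, mem_image, exists_exists_and_eq_and, Set.mem_smul_set, smul_eq_mul, X,
      mem_ofPred_eq]
    constructor
    · rintro ⟨⟨z, hz, rfl⟩, s, hs, h⟩
      refine ⟨s, ⟨⟨z, hz, h⟩, hs⟩, ?_⟩
      rw [← h]; simp [linproj, gV]; ring
    · rintro ⟨s, ⟨⟨z, hz, h⟩, hs⟩, rfl⟩
      refine ⟨⟨z, hz, ?_⟩, s, hs, ?_⟩
      · rw [← h]; simp [linproj, gV]; ring
      · simp [linproj, gV]; ring
  rw [h1, image_add_left, measure_preimage_add, Measure.addHaar_smul]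
  simp [abs_of_pos hs]

lemma hh_bound (R : ℝ) (hR : 0 < R) (S : Set ℂ)
    (hT : ∀ z ∈ S, 0 ≤ z.re ∧ 0 ≤ z.im ∧ z.re + z.im ≤ R) (θ : ℝ) :
    volume (linproj θ '' S) ≤ ENNReal.ofReal (4 * R) := by
  have : linproj θ '' S ⊆ Icc (-(2 * R)) (2 * R) := by
    rintro _ ⟨z, hz, rfl⟩
    obtain ⟨h1, h2, h3⟩ := hT z hz
    rw [mem_Icc, ← abs_le]
    unfold linproj
    calc _ ≤ |z.re * Real.cos θ| + |z.im * Real.sin θ| := abs_add_le _ _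
      _ = z.re * |Real.cos θ| + z.im * |Real.sin θ| := by
        rw [abs_mul, abs_mul, abs_of_nonneg h1, abs_of_nonneg h2]
      _ ≤ z.re * 1 + z.im * 1 := by
        gcongr
        · exact Real.abs_cos_le_one θ
        · exact Real.abs_sin_le_one θ
      _ ≤ 2 * R := by linarith
  refine (measure_mono this).trans ?_
  rw [Real.volume_Icc]
  apply ENNReal.ofReal_le_ofReal; linarith

lemma hhS_integrable (R : ℝ) (hR : 0 < R) (S : Set ℂ) (hS : MeasurableSet S)
    (hT : ∀ z ∈ S, 0 ≤ z.re ∧ 0 ≤ z.im ∧ z.re + z.im ≤ R) :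
    IntervalIntegrable (hh S S) volume 0 Real.pi := by
  rw [intervalIntegrable_iff_integrableOn_Ioc_of_le Real.pi_pos.le]
  have h := (slice_fubini (volume.restrict (Ioc 0 Real.pi)) (volume : Measure ℝ)
    (analytic_null' _ (FV_analytic S hS))).1
  refine Integrable.of_bound (C := 4 * R) ?_ (Eventually.of_forall fun θ => ?_)
  · unfold hh
    simp only [inter_self]
    exact h.ennreal_toReal.aestronglyMeasurable
  · unfold hh
    rw [inter_self, Real.norm_of_nonneg ENNReal.toReal_nonneg]
    exact ENNReal.toReal_le_of_le_ofReal (by positivity) (hh_bound R hR S hT θ)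

lemma hh_le (R : ℝ) (hR : 0 < R) (S B : Set ℂ)
    (hT : ∀ z ∈ S, 0 ≤ z.re ∧ 0 ≤ z.im ∧ z.re + z.im ≤ R) (θ : ℝ) : hh S B θ ≤ hh S S θ := by
  unfold hh
  rw [inter_self]
  exact ENNReal.toReal_mono (ne_top_of_le_ne_top ENNReal.ofReal_ne_top (hh_bound R hR S hT θ))
    (measure_mono inter_subset_left)

lemma lemmaV (R : ℝ) (hR : 0 < R) (S : Set ℂ) (hS : MeasurableSet S)
    (hT : ∀ z ∈ S, 0 ≤ z.re ∧ 0 ≤ z.im ∧ z.re + z.im ≤ R) :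
    IntegrableOn (fun s => vis (gV R s) S) (Icc (-R) (2 * R)) ∧
    IntervalIntegrable (hh S (gV R '' Icc (-R) (2 * R))) volume 0 Real.pi ∧
    (∫ θ in (0:ℝ)..Real.pi, hh S (gV R '' Icc (-R) (2 * R)) θ) ≤
      4 * Real.pi * ∫ s in Icc (-R) (2 * R), vis (gV R s) S ∧
    2 * Real.pi * (∫ s in Icc (-R) (2 * R), vis (gV R s) S) ≤
      3 * ∫ θ in (0:ℝ)..Real.pi, hh S (gV R '' Icc (-R) (2 * R)) θ := by
  set I := Icc (-R) (2 * R) with hI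
  obtain ⟨hw, hA, hfub⟩ := slice_fubini (volume.restrict (Ioo 0 Real.pi))
    ((volume : Measure ℝ).restrict I) (analytic_null' _ (GV_analytic R S hS))
  simp only [mem_ofPred_eq] at hw hA hfub
  set w : ℝ → ENNReal := fun θ => (volume.restrict I)
    {s | ∃ z ∈ S, linproj θ (gV R s) = linproj θ z} with hwdef
  set A : ℝ → ENNReal := fun s => (volume.restrict (Ioo 0 Real.pi))
    {θ | ∃ z ∈ S, linproj θ (gV R s) = linproj θ z} with hAdef
  set ℓ : ℝ → ENNReal := fun s => μH[1] (radialProj (gV R s) '' (S \ {gV R s})) with hℓdef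
  set g : ℝ → ENNReal := fun θ => volume (linproj θ '' S ∩ linproj θ '' (gV R '' I)) with hgdef
  have hradial := fun s => radial_eq R s hR S (fun z hz => (hT z hz).1)
  have hℓA : ∀ s, ℓ s ≤ A s := by
    intro s
    simp only [hℓdef, hAdef]
    rw [hradial s, Measure.restrict_apply' measurableSet_Ioo]
    exact ee_le _
  have hAℓ : ∀ s, A s ≤ 2 * ℓ s := by
    intro s
    simp only [hℓdef, hAdef]
    rw [hradial s, Measure.restrict_apply' measurableSet_Ioo]
    exact ee_ge _ inter_subset_right
  have hApi : ∀ s, A s ≤ ENNReal.ofReal Real.pi := by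
    intro s
    simp only [hAdef]
    rw [Measure.restrict_apply' measurableSet_Ioo]
    refine (measure_mono inter_subset_right).trans ?_
    rw [Real.volume_Ioo, sub_zero]
  have hℓm : AEMeasurable ℓ (volume.restrict I) := by
    have : IsFiniteMeasure ((μH[1] : Measure ℂ).restrict (ee '' Ioo 0 Real.pi)) := by
      refine ⟨?_⟩
      rw [Measure.restrict_apply_univ]
      refine (ee_le _).trans_lt ?_
      simp
    have h := (slice_fubini (volume.restrict I) ((μH[1] : Measure ℂ).restrict (ee '' Ioo 0 Real.pi))
      (analytic_null' _ (HV_analytic R S hS))).1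
    refine h.congr (Eventually.of_forall fun s => ?_)
    refine Measure.restrict_eq_self _ ?_
    change radialProj (gV R s) '' (S \ {gV R s}) ⊆ _
    rw [hradial s]
    exact image_mono fun θ h => h.2
  have hgw : ∀ θ ∈ Ioo 0 Real.pi, g θ = ENNReal.ofReal (Real.sin θ) * w θ := by
    intro θ hθ
    simp only [hgdef, hwdef]
    rw [Measure.restrict_apply' measurableSet_Icc]
    exact g_eq R S θ (Real.sin_pos_of_pos_of_lt_pi hθ.1 hθ.2)
  have hgw1 : ∀ θ ∈ Ioo 0 Real.pi, g θ ≤ w θ := by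
    intro θ hθ
    rw [hgw θ hθ]
    calc _ ≤ 1 * w θ := by
          gcongr
          rw [← ENNReal.ofReal_one]
          exact ENNReal.ofReal_le_ofReal (Real.sin_le_one θ)
      _ = _ := one_mul _
  have hgw2 : ∀ θ ∈ Ioo 0 Real.pi, w θ ≤ 3 * g θ := by
    intro θ hθ
    rw [hgw θ hθ]
    have hsp := Real.sin_pos_of_pos_of_lt_pi hθ.1 hθ.2
    rcases eq_empty_or_nonempty ({s | ∃ z ∈ S, linproj θ (gV R s) = linproj θ z} ∩ I) with he | hne
    · have : w θ = 0 := by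
        simp only [hwdef]
        rw [Measure.restrict_apply' measurableSet_Icc, he, measure_empty]
      rw [this]; simp
    · obtain ⟨s, ⟨z, hz, h⟩, hs1, hs2⟩ := hne
      obtain ⟨h1, h2, h3⟩ := hT z hz
      simp only [linproj, gV] at h
      have hc : |Real.cos θ| ≤ 2 * Real.sin θ := by
        have e : (z.re + R) * Real.cos θ = (s - z.im) * Real.sin θ := by linarith
        have hx : |s - z.im| ≤ 2 * R := by rw [abs_le]; constructor <;> linarith
        have e2 : (z.re + R) * |Real.cos θ| = |s - z.im| * Real.sin θ := by
          have := congrArg abs e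
          rwa [abs_mul, abs_mul, abs_of_pos hsp, abs_of_pos (by linarith : 0 < z.re + R)] at this
        have e3 : R * |Real.cos θ| ≤ (z.re + R) * |Real.cos θ| := by
          gcongr; linarith
        have e4 : |s - z.im| * Real.sin θ ≤ 2 * R * Real.sin θ := by gcongr
        have e5 : R * |Real.cos θ| ≤ R * (2 * Real.sin θ) := by linarith
        exact le_of_mul_le_mul_left e5 hR
      have hsin : 1 / 3 ≤ Real.sin θ := by
        have := Real.sin_sq_add_cos_sq θ
        have h4 : Real.cos θ ^ 2 ≤ (2 * Real.sin θ) ^ 2 := sq_le_sq' (by linarith [abs_le.1 hc]) (abs_le.1 hc).2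
        nlinarith
      rw [← mul_assoc]
      calc w θ = 1 * w θ := (one_mul _).symm
        _ ≤ _ := by
          gcongr
          have : (3 : ENNReal) = ENNReal.ofReal 3 := by simp
          rw [this, ← ENNReal.ofReal_mul (by norm_num), ← ENNReal.ofReal_one]
          apply ENNReal.ofReal_le_ofReal; linarith
  have hgm : AEMeasurable g (volume.restrict (Ioo 0 Real.pi)) := by
    have : AEMeasurable (fun θ => ENNReal.ofReal (Real.sin θ) * w θ)
        (volume.restrict (Ioo 0 Real.pi)) :=
      (by fun_prop : Measurable fun θ : ℝ => ENNReal.ofReal (Real.sin θ)).aemeasurable.mul hw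
    refine this.congr ?_
    filter_upwards [ae_restrict_mem measurableSet_Ioo] with θ hθ
    exact (hgw θ hθ).symm
  have hgb : ∀ θ, g θ ≤ ENNReal.ofReal (4 * R) := fun θ =>
    (measure_mono inter_subset_left).trans (hh_bound R hR S hT θ)
  have hgint : ∫⁻ θ in Ioo 0 Real.pi, g θ ≤ 2 * ∫⁻ s in I, ℓ s := by
    calc _ ≤ ∫⁻ θ in Ioo 0 Real.pi, w θ := setLIntegral_mono' measurableSet_Ioo hgw1
      _ = ∫⁻ s in I, A s := hfub
      _ ≤ ∫⁻ s in I, 2 * ℓ s := lintegral_mono hAℓ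
      _ = _ := lintegral_const_mul' _ _ (by simp)
  have hlint : ∫⁻ s in I, ℓ s ≤ 3 * ∫⁻ θ in Ioo 0 Real.pi, g θ := by
    calc _ ≤ ∫⁻ s in I, A s := lintegral_mono hℓA
      _ = ∫⁻ θ in Ioo 0 Real.pi, w θ := hfub.symm
      _ ≤ ∫⁻ θ in Ioo 0 Real.pi, 3 * g θ := setLIntegral_mono' measurableSet_Ioo hgw2
      _ = _ := lintegral_const_mul' _ _ (by simp)
  have hgfin : ∫⁻ θ in Ioo 0 Real.pi, g θ ≠ ⊤ := by
    refine ne_top_of_le_ne_top ?_ (lintegral_mono hgb)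
    simp [ENNReal.mul_eq_top]
  have hlfin : ∫⁻ s in I, ℓ s ≠ ⊤ :=
    ne_top_of_le_ne_top (ENNReal.mul_ne_top (by simp) hgfin) hlint
  have hlpt : ∀ s, ℓ s < ⊤ := fun s => ((hℓA s).trans (hApi s)).trans_lt ENNReal.ofReal_lt_top
  have hvis : ∀ s, vis (gV R s) S = (ℓ s).toReal / (2 * Real.pi) := fun s => rfl
  have hJ : 2 * Real.pi * ∫ s in I, vis (gV R s) S = (∫⁻ s in I, ℓ s).toReal := by
    simp only [hvis]
    rw [integral_div, integral_toReal hℓm (Eventually.of_forall hlpt)]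
    have := Real.pi_pos
    field_simp
  have hgJ : ∫ θ in (0:ℝ)..Real.pi, hh S (gV R '' I) θ =
      (∫⁻ θ in Ioo 0 Real.pi, g θ).toReal := by
    rw [intervalIntegral.integral_of_le Real.pi_pos.le, integral_Ioc_eq_integral_Ioo]
    exact integral_toReal hgm (Eventually.of_forall fun θ => (hgb θ).trans_lt ENNReal.ofReal_lt_top)
  refine ⟨?_, ?_, ?_, ?_⟩
  · simp only [hvis]
    exact (integrable_toReal_of_lintegral_ne_top hℓm hlfin).div_const _
  · rw [intervalIntegrable_iff_integrableOn_Ioo_of_le Real.pi_pos.le]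
    exact integrable_toReal_of_lintegral_ne_top hgm hgfin
  · rw [hgJ, show 4 * Real.pi * ∫ s in I, vis (gV R s) S = 2 * (2 * Real.pi * ∫ s in I, vis (gV R s) S) by ring, hJ]
    have := ENNReal.toReal_mono (ENNReal.mul_ne_top (by simp) hlfin) hgint
    simpa using this
  · rw [hgJ, hJ]
    have := ENNReal.toReal_mono (ENNReal.mul_ne_top (by simp) hgfin) hlint
    simpa using this
lemma gV_isometry (R : ℝ) : Isometry (gV R) := by
  refine Isometry.of_dist_eq fun s t => ?_
  rw [Complex.dist_eq_re_im, Real.dist_eq]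
  simp [gV, Real.sqrt_sq_eq_abs]

lemma sw_isometry : Isometry sw := by
  refine Isometry.of_dist_eq fun s t => ?_
  rw [Complex.dist_eq_re_im, Complex.dist_eq_re_im]
  simp only [sw]
  rw [add_comm]

lemma sw_sw (z : ℂ) : sw (sw z) = z := rfl

lemma sw_image (S : Set ℂ) : sw '' S = sw ⁻¹' S := by
  ext z
  constructor
  · rintro ⟨w, hw, rfl⟩; exact hw
  · intro h; exact ⟨sw z, h, rfl⟩

lemma sw_image_image (S : Set ℂ) : sw '' (sw '' S) = S := by
  rw [image_image]; simp [sw_sw]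

lemma vis_sw (a : ℂ) (S : Set ℂ) : vis (sw a) S = vis a (sw '' S) := by
  have h : ∀ z, radialProj (sw a) (sw z) = sw (radialProj a z) := by
    intro z
    have h1 : ‖sw z - sw a‖ = ‖z - a‖ := by
      rw [← dist_eq_norm, ← dist_eq_norm, sw_isometry.dist_eq]
    unfold radialProj
    rw [h1]
    apply Complex.ext <;> simp [sw]
  have h2 : radialProj (sw a) '' (S \ {sw a}) = sw '' (radialProj a '' (sw '' S \ {a})) := by
    rw [image_image]
    simp only [← h]
    rw [← image_image (radialProj (sw a)) sw, image_sdiff sw_isometry.injective, sw_image_image,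
      image_singleton]
  unfold vis
  rw [h2, sw_isometry.hausdorffMeasure_image (Or.inl (by norm_num))]

lemma iso_integral (γ : ℝ → ℂ) (hγ : Isometry γ) (I : Set ℝ) (F : ℂ → ℝ) :
    (∫ a in γ '' I, F a ∂μH[1]) = (∫ s in I, F (γ s)) ∧
    (IntegrableOn F (γ '' I) μH[1] ↔ IntegrableOn (fun s => F (γ s)) I) := by
  have he : MeasurableEmbedding γ := hγ.isClosedEmbedding.measurableEmbedding
  have hm : (μH[1] : Measure ℂ).restrict (γ '' I) = (volume.restrict I).map γ := by
    have h1 := hγ.map_hausdorffMeasure (d := 1) (Or.inl (by norm_num))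
    rw [hausdorffMeasure_real] at h1
    have h2 := he.restrict_map volume (γ '' I)
    rw [h1, preimage_image_eq _ hγ.injective, Measure.restrict_restrict_of_subset (image_subset_range _ _)] at h2
    exact h2
  unfold IntegrableOn
  rw [hm]
  exact ⟨he.integral_map F, he.integrable_map_iff⟩

lemma IV_eq (R : ℝ) (hR : 0 < R) : IV R = gV R '' Icc (-R) (2 * R) := by
  unfold IV
  rw [← segment_eq_Icc (by linarith)]
  ext z
  simp only [segment, mem_image, mem_ofPred_eq]
  constructor
  · rintro ⟨a, b, ha, hb, hab, rfl⟩
    refine ⟨_, ⟨a, b, ha, hb, hab, rfl⟩, ?_⟩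
    apply Complex.ext
    · simp [gV]; linear_combination (-R) * (hab.symm)
    · simp [gV]
  · rintro ⟨_, ⟨a, b, ha, hb, hab, rfl⟩, rfl⟩
    refine ⟨a, b, ha, hb, hab, ?_⟩
    apply Complex.ext
    · simp [gV]; linear_combination (-R) * hab
    · simp [gV]

lemma IH_eq (R : ℝ) (hR : 0 < R) : IH R = sw '' (IV R) := by
  unfold IH IV
  ext z
  simp only [segment, mem_image, mem_ofPred_eq]
  constructor
  · rintro ⟨a, b, ha, hb, hab, rfl⟩
    refine ⟨_, ⟨a, b, ha, hb, hab, rfl⟩, ?_⟩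
    apply Complex.ext <;> simp [sw]
  · rintro ⟨_, ⟨a, b, ha, hb, hab, rfl⟩, rfl⟩
    refine ⟨a, b, ha, hb, hab, ?_⟩
    apply Complex.ext <;> simp [sw]

lemma T_bounds (R : ℝ) (hR : 0 < R) (z : ℂ) (hz : z ∈ Tprime R) :
    0 ≤ z.re ∧ 0 ≤ z.im ∧ z.re + z.im ≤ R := by
  have hc : Convex ℝ {z : ℂ | 0 ≤ z.re ∧ 0 ≤ z.im ∧ z.re + z.im ≤ R} := by
    rintro x ⟨h1, h2, h3⟩ y ⟨h4, h5, h6⟩ a b ha hb hab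
    simp only [mem_ofPred_eq, Complex.add_re, Complex.add_im, Complex.real_smul,
      Complex.re_ofReal_mul, Complex.im_ofReal_mul]
    refine ⟨by positivity, by positivity, ?_⟩
    have e1 := mul_le_mul_of_nonneg_left h3 ha
    have e2 := mul_le_mul_of_nonneg_left h6 hb
    have e3 : a * R + b * R = R := by rw [← add_mul, hab, one_mul]
    linarith
  refine convexHull_min ?_ hc hz
  intro w hw
  simp only [mem_insert_iff, mem_singleton_iff] at hw
  rcases hw with rfl | rfl | rfl <;> simp [hR.le]

lemma cover (R : ℝ) (hR : 0 < R) (z : ℂ)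
    (hz : 0 ≤ z.re ∧ 0 ≤ z.im ∧ z.re + z.im ≤ R) (θ : ℝ) :
    linproj θ z ∈ linproj θ '' (gV R '' Icc (-R) (2 * R)) ∪
      linproj θ '' (sw '' (gV R '' Icc (-R) (2 * R))) := by
  obtain ⟨h1, h2, h3⟩ := hz
  have hle : -R ≤ 2 * R := by linarith
  have key : ∀ f : ℝ → ℝ, Continuous f → linproj θ z ∈ uIcc (f (-R)) (f (2 * R)) →
      linproj θ z ∈ f '' Icc (-R) (2 * R) := by
    intro f hf h
    rw [← uIcc_of_le hle]
    exact intermediate_value_uIcc hf.continuousOn h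
  have c1 : Continuous fun s => linproj θ (gV R s) := by
    have := gV_cont R
    exact linproj_cont.comp (by fun_prop : Continuous fun s => (θ, gV R s))
  have c2 : Continuous fun s => linproj θ (sw (gV R s)) := by
    have := gV_cont R
    have := sw_isometry.continuous
    exact linproj_cont.comp (by fun_prop : Continuous fun s => (θ, sw (gV R s)))
  rw [image_image, image_image, image_image]
  by_contra hcon
  rw [mem_union, not_or] at hcon
  have k1 : ¬ _ := fun h => hcon.1 (key _ c1 h)
  have k2 : ¬ _ := fun h => hcon.2 (key _ c2 h)
  set t := linproj θ z with ht
  set d0 := linproj θ (gV R (-R)) with hd0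
  set d1 := linproj θ (gV R (2 * R)) with hd1
  set d2 := linproj θ (sw (gV R (2 * R))) with hd2
  have hd0' : linproj θ (sw (gV R (-R))) = d0 := by simp [hd0, linproj, sw, gV]
  rw [hd0'] at k2
  have hcomb : (R - z.re - z.im) * (d0 - t) + (z.im + R) * (d1 - t) + (z.re + R) * (d2 - t) = 0 := by
    simp only [hd0, hd1, hd2, ht, linproj, sw, gV]; ring
  have p1 : 0 < z.im + R := by linarith
  have p2 : 0 < z.re + R := by linarith
  have p0 : 0 ≤ R - z.re - z.im := by linarith
  rw [mem_uIcc] at k1 k2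
  push Not at k1 k2
  rcases le_or_gt d0 t with h | h
  · have a1 := k1.1 h
    have a2 := k2.1 h
    have b1 := mul_neg_of_pos_of_neg p1 (sub_neg.2 a1)
    have b2 := mul_neg_of_pos_of_neg p2 (sub_neg.2 a2)
    have b0 := mul_nonpos_of_nonneg_of_nonpos p0 (sub_nonpos.2 h)
    linarith
  · have a1 : t < d1 := by
      by_contra! h'; exact absurd (k1.2 h') (not_lt.2 h.le)
    have a2 : t < d2 := by
      by_contra! h'; exact absurd (k2.2 h') (not_lt.2 h.le)
    have b1 := mul_pos p1 (sub_pos.2 a1)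
    have b2 := mul_pos p2 (sub_pos.2 a2)
    have b0 := mul_nonneg p0 (sub_pos.2 h).le
    linarith

lemma hh_cover (R : ℝ) (hR : 0 < R) (S : Set ℂ)
    (hT : ∀ z ∈ S, 0 ≤ z.re ∧ 0 ≤ z.im ∧ z.re + z.im ≤ R) (θ : ℝ) :
    hh S S θ ≤ hh S (gV R '' Icc (-R) (2 * R)) θ + hh S (sw '' (gV R '' Icc (-R) (2 * R))) θ := by
  unfold hh
  have hfin : ∀ B : Set ℝ, volume (linproj θ '' S ∩ B) ≠ ⊤ := fun B =>
    ne_top_of_le_ne_top ENNReal.ofReal_ne_top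
      ((measure_mono inter_subset_left).trans (hh_bound R hR S hT θ))
  rw [← ENNReal.toReal_add (hfin _) (hfin _)]
  refine ENNReal.toReal_mono (ENNReal.add_ne_top.2 ⟨hfin _, hfin _⟩) ?_
  refine (measure_mono ?_).trans (measure_union_le _ _)
  rw [← inter_union_distrib_left, inter_self]
  refine subset_inter subset_rfl ?_
  rintro _ ⟨z, hz, rfl⟩
  exact cover R hR z (hT z hz) θ

lemma Fav_eq (S : Set ℂ) : Real.pi * Fav S = ∫ θ in (0:ℝ)..Real.pi, hh S S θ := by
  unfold Fav hh
  simp only [inter_self]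
  have := Real.pi_pos
  field_simp

end Aux

/-- The Favard length of `S ⊆ T′` is comparable to the average visibility of `S`
from the vantage points on `I_V ∪ I_H`, with absolute comparability constants. -/
theorem stmt3 :
    ∃ c C : ℝ, 0 < c ∧ 0 < C ∧
      ∀ (R : ℝ) (S : Set ℂ), 0 < R → MeasurableSet S → S ⊆ Tprime R →
        c * Fav S ≤ (∫ a in (IV R ∪ IH R), vis a S ∂μH[1]) ∧
        (∫ a in (IV R ∪ IH R), vis a S ∂μH[1]) ≤ C * Fav S := by
  refine ⟨1 / 4, 3, by norm_num, by norm_num, ?_⟩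
  intro R S hR hS hST
  have hT : ∀ z ∈ S, 0 ≤ z.re ∧ 0 ≤ z.im ∧ z.re + z.im ≤ R := fun z hz =>
    T_bounds R hR z (hST hz)
  have hS' : MeasurableSet (sw '' S) := by
    rw [sw_image]; exact sw_isometry.continuous.measurable hS
  have hT' : ∀ z ∈ sw '' S, 0 ≤ z.re ∧ 0 ≤ z.im ∧ z.re + z.im ≤ R := by
    rintro _ ⟨z, hz, rfl⟩
    obtain ⟨h1, h2, h3⟩ := hT z hz
    refine ⟨h2, h1, ?_⟩
    simp only [sw]; linarith
  obtain ⟨v1, v2, v3, v4⟩ := lemmaV R hR S hS hT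
  obtain ⟨w1, w2, w3, w4⟩ := lemmaV R hR (sw '' S) hS' hT'
  set I := Icc (-R) (2 * R) with hI
  obtain ⟨iV, iV'⟩ := iso_integral (gV R) (gV_isometry R) I (fun a => vis a S)
  obtain ⟨iH, iH'⟩ := iso_integral (fun s => sw (gV R s)) (sw_isometry.comp (gV_isometry R)) I
    (fun a => vis a S)
  rw [← image_image sw (gV R)] at iH iH'
  simp only [vis_sw] at iH iH'
  rw [← IV_eq R hR] at iV iV' iH iH' v2 v3 v4 w2 w3 w4
  rw [← IH_eq R hR] at iH iH'
  have hdis : AEDisjoint μH[1] (IV R) (IH R) := by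
    have hsub : IV R ∩ IH R ⊆ {(⟨-R, -R⟩ : ℂ)} := by
      rw [IH_eq R hR, IV_eq R hR]
      rintro z ⟨⟨s, -, hs⟩, ⟨_, ⟨t, -, rfl⟩, ht⟩⟩
      rw [mem_singleton_iff]
      apply Complex.ext
      · rw [← hs]; rfl
      · rw [← ht]; rfl
    have : NullSingletonClass (μH[1] : Measure ℂ) := Measure.nullSingletonClass_hausdorff ℂ (by norm_num)
    exact measure_mono_null hsub (measure_singleton _)
  have hIHm : MeasurableSet (IH R) := by
    have e : IH R = (fun s => sw (gV R s)) '' I := by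
      rw [IH_eq R hR, IV_eq R hR, image_image]
    rw [e]
    exact (isCompact_Icc.image (sw_isometry.comp (gV_isometry R)).continuous).isClosed.measurableSet
  have hunion : (∫ a in (IV R ∪ IH R), vis a S ∂μH[1]) =
      (∫ s in I, vis (gV R s) S) + ∫ s in I, vis (gV R s) (sw '' S) := by
    rw [← iV, ← iH]
    exact setIntegral_union₀ hdis hIHm.nullMeasurableSet (iV'.2 v1) (iH'.2 w1)
  have hfi := hhS_integrable R hR S hS hT
  have hfi' := hhS_integrable R hR _ hS' hT'
  have hF' : ∫ θ in (0:ℝ)..Real.pi, hh (sw '' S) (sw '' S) θ = Real.pi * Fav S := by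
    rw [hh_integral_sw, Fav_eq]
  have hgH := hh_integral_sw (sw '' S) (IV R)
  have hgHi := hh_integrable_sw (sw '' S) (IV R) w2
  rw [sw_image_image] at hgH hgHi
  have u1 : ∫ θ in (0:ℝ)..Real.pi, hh S (IV R) θ ≤ ∫ θ in (0:ℝ)..Real.pi, hh S S θ :=
    intervalIntegral.integral_mono_on Real.pi_pos.le v2 hfi fun θ _ => hh_le R hR S _ hT θ
  have u2 : ∫ θ in (0:ℝ)..Real.pi, hh (sw '' S) (IV R) θ ≤
      ∫ θ in (0:ℝ)..Real.pi, hh (sw '' S) (sw '' S) θ :=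
    intervalIntegral.integral_mono_on Real.pi_pos.le w2 hfi' fun θ _ => hh_le R hR _ _ hT' θ
  have u3 : ∫ θ in (0:ℝ)..Real.pi, hh S S θ ≤
      (∫ θ in (0:ℝ)..Real.pi, hh S (IV R) θ) + ∫ θ in (0:ℝ)..Real.pi, hh S (sw '' IV R) θ := by
    rw [← intervalIntegral.integral_add v2 hgHi]
    refine intervalIntegral.integral_mono_on Real.pi_pos.le hfi (v2.add hgHi) fun θ _ => ?_
    have := hh_cover R hR S hT θ
    rw [← hI, ← IV_eq R hR] at this
    exact this
  rw [← Fav_eq] at u1 u3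
  rw [hF'] at u2
  rw [hgH] at u3
  rw [hunion]
  have hpi := Real.pi_pos
  constructor
  · refine le_of_mul_le_mul_left (a := 4 * Real.pi) ?_ (by positivity)
    linarith
  · refine le_of_mul_le_mul_left (a := 2 * Real.pi) ?_ (by positivity)
    linarith
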